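/- For every convex f in F and every 0 < c < 1, the water-filling width satisfies max{(c/2)^{2/3}, c} ≤ ρ_z(cε; f)/ρ_z(ε; f) ≤ 1. -/

import Mathlib

open MeasureTheory Set

/-- L2 distance between two functions on [0,1]. -/
noncomputable def L2 (f g : ℝ → ℝ) : ℝ :=
  Real.sqrt (∫ t in (0:ℝ)..1, (f t - g t) ^ 2)

/-- Truncation f_u(t) = max{f(t), u}. -/
def trunc (f : ℝ → ℝ) (u : ℝ) : ℝ → ℝ := fun t => max (f t) u

/-- z is the unique minimizer of f on [0,1]. -/
def UniqueMinOn (f : ℝ → ℝ) (z : ℝ) : Prop :=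
  z ∈ Icc (0:ℝ) 1 ∧ ∀ t ∈ Icc (0:ℝ) 1, t ≠ z → f z < f t

/-- Water-filling depth ρ_m(ε; f), where Mf is the minimum of f. -/
noncomputable def rhoM (ε : ℝ) (f : ℝ → ℝ) (Mf : ℝ) : ℝ :=
  sSup {v | ∃ u, v = u - Mf ∧ L2 f (trunc f u) ≤ ε}

/-- Water-filling width ρ_z(ε; f), where Zf is the minimizer and Mf the minimum of f. -/
noncomputable def rhoZ (ε : ℝ) (f : ℝ → ℝ) (Zf Mf : ℝ) : ℝ :=
  sSup {v | ∃ t ∈ Icc (0:ℝ) 1, v = |t - Zf| ∧ f t ≤ rhoM ε f Mf + Mf}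

/-- Local modulus of continuity of the minimum. -/
noncomputable def omegaM (ε : ℝ) (f : ℝ → ℝ) (Mf : ℝ) : ℝ :=
  sSup {v | ∃ g zg, ConvexOn ℝ (Icc (0:ℝ) 1) g ∧ UniqueMinOn g zg ∧
    L2 f g ≤ ε ∧ v = |Mf - g zg|}

/-- Local modulus of continuity of the minimizer. -/
noncomputable def omegaZ (ε : ℝ) (f : ℝ → ℝ) (Zf : ℝ) : ℝ :=
  sSup {v | ∃ g zg, ConvexOn ℝ (Icc (0:ℝ) 1) g ∧ UniqueMinOn g zg ∧
    L2 f g ≤ ε ∧ v = |Zf - zg|}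

/-- The squared positive part of `u - f`. -/
noncomputable def pp (f : ℝ → ℝ) (u : ℝ) : ℝ → ℝ := fun t => (max (u - f t) 0) ^ 2

lemma pp_nonneg (f : ℝ → ℝ) (u t : ℝ) : 0 ≤ pp f u t := sq_nonneg _

lemma L2_trunc (f : ℝ → ℝ) (u : ℝ) :
    L2 f (trunc f u) = Real.sqrt (∫ t in (0:ℝ)..1, pp f u t) := by
  unfold L2 trunc pp
  congr 1
  apply intervalIntegral.integral_congr
  intro t _
  simp only
  rcases le_total (f t) u with h | h
  · rw [max_eq_right h, max_eq_left (by linarith)]; ring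
  · rw [max_eq_left h, max_eq_right (by linarith)]; ring

lemma pp_le (f : ℝ → ℝ) (z u B : ℝ) (hmin : ∀ t ∈ Icc (0:ℝ) 1, f z ≤ f t) (hB : u - f z ≤ B)
    (hB0 : 0 ≤ B) (t : ℝ) (ht : t ∈ Icc (0:ℝ) 1) : pp f u t ≤ B ^ 2 := by
  unfold pp
  have := hmin t ht
  apply pow_le_pow_left₀ (le_max_right _ _)
  exact max_le (by linarith) hB0

lemma pp_meas (f : ℝ → ℝ) (hf : ConvexOn ℝ (Icc (0:ℝ) 1) f) (u : ℝ) :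
    AEStronglyMeasurable (pp f u) (volume.restrict (Ioc (0:ℝ) 1)) := by
  rw [← Measure.restrict_congr_set (Ioo_ae_eq_Ioc (μ := volume) (a := (0:ℝ)) (b := 1))]
  have hc : ContinuousOn f (Ioo (0:ℝ) 1) :=
    (hf.subset Ioo_subset_Icc_self (convex_Ioo 0 1)).continuousOn isOpen_Ioo
  have : ContinuousOn (pp f u) (Ioo (0:ℝ) 1) := by
    unfold pp
    exact ((continuousOn_const.sub hc).sup continuousOn_const).pow 2
  exact this.aestronglyMeasurable measurableSet_Ioo

lemma pp_int01 (f : ℝ → ℝ) (hf : ConvexOn ℝ (Icc (0:ℝ) 1) f) (z u : ℝ)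
    (hmin : ∀ t ∈ Icc (0:ℝ) 1, f z ≤ f t) : IntervalIntegrable (pp f u) volume 0 1 := by
  rw [intervalIntegrable_iff_integrableOn_Ioc_of_le zero_le_one]
  refine Integrable.mono' (g := fun _ => |u - f z| ^ 2) ?_ (pp_meas f hf u) ?_
  · exact integrable_const _
  · refine (ae_restrict_iff' measurableSet_Ioc).2 (Filter.Eventually.of_forall fun t ht => ?_)
    rw [Real.norm_of_nonneg (pp_nonneg f u t)]
    exact pp_le f z u _ hmin (le_abs_self _) (abs_nonneg _) t (Ioc_subset_Icc_self ht)

lemma pp_int (f : ℝ → ℝ) (hf : ConvexOn ℝ (Icc (0:ℝ) 1) f) (z u : ℝ)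
    (hmin : ∀ t ∈ Icc (0:ℝ) 1, f z ≤ f t) (a b : ℝ) (ha : a ∈ Icc (0:ℝ) 1)
    (hb : b ∈ Icc (0:ℝ) 1) : IntervalIntegrable (pp f u) volume a b := by
  apply (pp_int01 f hf z u hmin).mono_set
  rw [uIcc_of_le (zero_le_one' ℝ)]
  exact (convex_Icc (0:ℝ) 1).ordConnected.uIcc_subset ha hb

lemma h_cont (f : ℝ → ℝ) (hf : ConvexOn ℝ (Icc (0:ℝ) 1) f) (z : ℝ)
    (hmin : ∀ t ∈ Icc (0:ℝ) 1, f z ≤ f t) :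
    Continuous (fun u => ∫ t in (0:ℝ)..1, pp f u t) := by
  rw [continuous_iff_continuousAt]
  intro u₀
  refine intervalIntegral.continuousAt_of_dominated_interval
    (bound := fun _ => (|u₀ - f z| + 1) ^ 2) ?_ ?_ ?_ ?_
  · refine Filter.Eventually.of_forall fun u => ?_
    rw [uIoc_of_le zero_le_one]; exact pp_meas f hf u
  · have : ∀ᶠ u in nhds u₀, u < u₀ + 1 := eventually_lt_nhds (by linarith)
    filter_upwards [this] with u hu
    refine Filter.Eventually.of_forall fun t ht => ?_
    rw [uIoc_of_le zero_le_one] at ht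
    rw [Real.norm_of_nonneg (pp_nonneg f u t)]
    refine pp_le f z u _ hmin ?_ (by positivity) t (Ioc_subset_Icc_self ht)
    have := le_abs_self (u₀ - f z)
    linarith
  · exact intervalIntegrable_const
  · refine Filter.Eventually.of_forall fun t _ => ?_
    unfold pp
    exact Continuous.continuousAt (by fun_prop)

lemma comb (f : ℝ → ℝ) (hf : ConvexOn ℝ (Icc (0:ℝ) 1) f) (y x t : ℝ)
    (hy : y ∈ Icc (0:ℝ) 1) (ht : t ∈ Icc (0:ℝ) 1) (h1 : y ≤ x) (h2 : x ≤ t) :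
    (t - y) * f x ≤ (t - x) * f y + (x - y) * f t := by
  rcases eq_or_lt_of_le (h1.trans h2) with h | h
  · have : x = y := by linarith
    subst this; subst h; linarith
  · have hp : 0 < t - y := by linarith
    have hs : (t - x)/(t-y) + (x-y)/(t-y) = 1 := by field_simp; ring
    have := hf.2 hy ht (div_nonneg (by linarith : 0 ≤ t - x) hp.le)
      (div_nonneg (by linarith : 0 ≤ x - y) hp.le) hs
    simp only [smul_eq_mul] at this
    have e : (t - x)/(t-y) * y + (x-y)/(t-y) * t = x := by field_simp; ring
    rw [e] at this
    have h3 := mul_le_mul_of_nonneg_left this hp.le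
    have e2 : (t - y) * ((t - x)/(t-y) * f y + (x-y)/(t-y) * f t)
      = (t - x) * f y + (x - y) * f t := by field_simp
    linarith

lemma ptwise (f : ℝ → ℝ) (hf : ConvexOn ℝ (Icc (0:ℝ) 1) f) (z t x r u u' : ℝ)
    (hz : z ∈ Icc (0:ℝ) 1) (ht : t ∈ Icc (0:ℝ) 1) (hx1 : z ≤ x) (hx2 : x ≤ t)
    (hr0 : 0 < r) (hr1 : r < 1) (hu : f t ≤ u) (hu' : u' ≤ f (z + r * (t - z))) :
    u' - f (z + r * (x - z)) ≤ r * (u - f x) := by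
  rcases eq_or_lt_of_le hx2 with h | h
  · subst h
    nlinarith
  · have hxz : r * (x - z) ≤ x - z := by nlinarith
    have htz : r * (t - z) ≤ t - z := by nlinarith
    have hxt : r * (x - z) ≤ r * (t - z) := by nlinarith
    have hx0 : 0 ≤ r * (x - z) := by nlinarith
    have hy : z + r * (x - z) ∈ Icc (0:ℝ) 1 := ⟨by linarith [hz.1], by linarith [ht.2]⟩
    have c1 := comb f hf (z + r * (x - z)) x t hy ht (by linarith) h.le
    have c2 := comb f hf (z + r * (x - z)) (z + r * (t - z)) t hy ht (by linarith) (by linarith)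
    have hp : 0 < t - (z + r * (x - z)) := by linarith
    have c3 := mul_le_mul_of_nonneg_left c1 hr0.le
    generalize f (z + r * (x - z)) = Y at *
    generalize f (z + r * (t - z)) = Q at *
    have key : (t - (z + r * (x - z))) * (Q - Y - r * (f t - f x)) ≤ 0 := by
      linarith
    have key2 : Q - Y - r * (f t - f x) ≤ 0 := by
      by_contra hcon
      push Not at hcon
      have := mul_pos hp hcon
      linarith
    have : r * f t ≤ r * u := mul_le_mul_of_nonneg_left hu hr0.le
    linarith

lemma core (f : ℝ → ℝ) (hf : ConvexOn ℝ (Icc (0:ℝ) 1) f) (z t r u u' : ℝ)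
    (hz : z ∈ Icc (0:ℝ) 1) (ht : t ∈ Icc (0:ℝ) 1) (hzt : z < t)
    (hmin : ∀ t ∈ Icc (0:ℝ) 1, f z ≤ f t)
    (hr0 : 0 < r) (hr1 : r < 1) (hu : f t ≤ u) (hu'0 : f z ≤ u')
    (hout : ∀ x ∈ Icc (0:ℝ) 1, r * |t - z| ≤ |x - z| → u' ≤ f x) :
    (∫ x in (0:ℝ)..1, pp f u' x) ≤ 4 * r ^ 3 * ∫ x in (0:ℝ)..1, pp f u x := by
  have hw : 0 < t - z := by linarith
  rw [abs_of_pos hw] at hout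
  have hrw : 0 < r * (t - z) := mul_pos hr0 hw
  have hrw1 : r * (t - z) < t - z := by nlinarith
  have hq : z + r * (t - z) ∈ Icc (0:ℝ) 1 := ⟨by linarith [hz.1], by linarith [ht.2]⟩
  have hQ : u' ≤ f (z + r * (t - z)) := by
    apply hout _ hq
    rw [add_sub_cancel_left, abs_of_pos hrw]
  have h0 : (0:ℝ) ∈ Icc (0:ℝ) 1 := by simp
  have h1 : (1:ℝ) ∈ Icc (0:ℝ) 1 := by simp
  set a := max 0 (z - r * (t - z)) with ha
  have haz : a ≤ z := max_le hz.1 (by linarith)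
  have haI : a ∈ Icc (0:ℝ) 1 := ⟨le_max_left _ _, haz.trans hz.2⟩
  have I := fun u a b ha hb => pp_int f hf z u hmin a b ha hb
  have zero : ∀ x ∈ Icc (0:ℝ) 1, r * (t - z) ≤ |x - z| → pp f u' x = 0 := by
    intro x hx hd
    have := hout x hx hd
    unfold pp
    rw [max_eq_right (by linarith)]; ring
  -- far left
  have e1 : (∫ x in (0:ℝ)..a, pp f u' x) = 0 := by
    rcases le_total (z - r * (t - z)) 0 with h | h
    · rw [ha, max_eq_left h]; simp
    · have haa : a = z - r * (t - z) := max_eq_right h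
      refine (intervalIntegral.integral_congr (g := fun _ => (0:ℝ)) ?_).trans
        intervalIntegral.integral_zero
      intro x hx
      rw [uIcc_of_le haI.1] at hx
      apply zero x ⟨hx.1, hx.2.trans haI.2⟩
      rw [abs_sub_comm]
      refine le_trans ?_ (le_abs_self _)
      linarith [hx.2]
  have e4 : (∫ x in (z + r * (t - z))..1, pp f u' x) = 0 := by
    refine (intervalIntegral.integral_congr (g := fun _ => (0:ℝ)) ?_).trans
      intervalIntegral.integral_zero
    intro x hx
    rw [uIcc_of_le hq.2] at hx
    apply zero x ⟨hq.1.trans hx.1, hx.2⟩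
    refine le_trans ?_ (le_abs_self _)
    linarith [hx.1]
  have e2 : (∫ x in a..z, pp f u' x) ≤ r * (t - z) * (u' - f z) ^ 2 := by
    have : (∫ x in a..z, pp f u' x) ≤ ∫ x in a..z, (u' - f z) ^ 2 := by
      apply intervalIntegral.integral_mono_on haz (I u' a z haI hz) intervalIntegrable_const
      intro x hx
      exact pp_le f z u' _ hmin le_rfl (by linarith) x ⟨haI.1.trans hx.1, hx.2.trans hz.2⟩
    rw [intervalIntegral.integral_const, smul_eq_mul] at this
    refine this.trans (mul_le_mul_of_nonneg_right ?_ (sq_nonneg _))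
    have := le_max_right 0 (z - r * (t - z))
    linarith
  have e3 : (∫ x in z..(z + r * (t - z)), pp f u' x) ≤ r ^ 3 * ∫ x in z..t, pp f u x := by
    have s := intervalIntegral.smul_integral_comp_add_mul (a := z) (b := t) (pp f u') r (z - r * z)
    rw [show z - r * z + r * z = z by ring, show z - r * z + r * t = z + r * (t - z) by ring,
      smul_eq_mul] at s
    rw [← s]
    have : (∫ x in z..t, pp f u' (z - r * z + r * x)) ≤ ∫ x in z..t, r ^ 2 * pp f u x := by
      rw [intervalIntegral.integral_of_le hzt.le, intervalIntegral.integral_of_le hzt.le]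
      apply integral_mono_of_nonneg
      · exact Filter.Eventually.of_forall fun x => pp_nonneg _ _ _
      · exact ((I u z t hz ht).const_mul (r ^ 2)).1
      · refine (ae_restrict_iff' measurableSet_Ioc).2 (Filter.Eventually.of_forall fun x hx => ?_)
        have := ptwise f hf z t x r u u' hz ht hx.1.le hx.2 hr0 hr1 hu hQ
        simp only [pp]
        rw [show z - r * z + r * x = z + r * (x - z) by ring, ← mul_pow]
        apply pow_le_pow_left₀ (le_max_right _ _)
        apply max_le
        · exact this.trans (mul_le_mul_of_nonneg_left (le_max_left _ _) hr0.le)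
        · exact mul_nonneg hr0.le (le_max_right _ _)
    rw [intervalIntegral.integral_const_mul] at this
    calc _ ≤ r * (r ^ 2 * ∫ x in z..t, pp f u x) := mul_le_mul_of_nonneg_left this hr0.le
      _ = _ := by ring
  have hd : u' - f z ≤ r * (u - f z) := by
    have := ptwise f hf z t z r u u' hz ht le_rfl hzt.le hr0 hr1 hu hQ
    simpa using this
  have e5 : (u - f z) ^ 2 * (t - z) / 3 ≤ ∫ x in z..t, pp f u x := by
    have hi : (∫ x in z..t, ((u - f z) / (t - z)) ^ 2 * (t - x) ^ 2)
        = (u - f z) ^ 2 * (t - z) / 3 := by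
      rw [intervalIntegral.integral_const_mul,
        intervalIntegral.integral_comp_sub_left (fun y => y ^ 2) t, integral_pow]
      field_simp
      norm_num
    rw [← hi]
    apply intervalIntegral.integral_mono_on hzt.le
      (Continuous.intervalIntegrable (by fun_prop) _ _) (I u z t hz ht)
    intro x hx
    have c := comb f hf z x t hz ht hx.1 hx.2
    rw [← mul_pow]
    unfold pp
    have hfz := hmin t ht
    apply pow_le_pow_left₀
    · exact mul_nonneg (div_nonneg (by linarith) hw.le) (by linarith [hx.2])
    · refine le_trans ?_ (le_max_left _ _)
      rw [div_mul_eq_mul_div, div_le_iff₀ hw]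
      have := mul_le_mul_of_nonneg_left hu (sub_nonneg.2 hx.1)
      linarith
  have e6 : (∫ x in z..t, pp f u x) ≤ ∫ x in (0:ℝ)..1, pp f u x := by
    apply intervalIntegral.integral_mono_interval hz.1 hzt.le ht.2
    · exact Filter.Eventually.of_forall fun x => pp_nonneg _ _ _
    · exact I u 0 1 h0 h1
  have s1 := intervalIntegral.integral_add_adjacent_intervals (I u' 0 a h0 haI) (I u' a z haI hz)
  have s2 := intervalIntegral.integral_add_adjacent_intervals (I u' 0 z h0 hz) (I u' z _ hz hq)
  have s3 := intervalIntegral.integral_add_adjacent_intervals (I u' 0 _ h0 hq) (I u' _ 1 hq h1)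
  have d2 : (u' - f z) ^ 2 ≤ (r * (u - f z)) ^ 2 := pow_le_pow_left₀ (by linarith) hd 2
  have d3 := mul_le_mul_of_nonneg_left d2 hrw.le
  have d4 := mul_le_mul_of_nonneg_left e5 (by positivity : 0 ≤ 3 * r ^ 3)
  have d5 := mul_le_mul_of_nonneg_left e6 (by positivity : 0 ≤ 4 * r ^ 3)
  have d6 : r * (t - z) * (r * (u - f z)) ^ 2 = 3 * r ^ 3 * ((u - f z) ^ 2 * (t - z) / 3) := by
    ring
  linarith

lemma core2 (f : ℝ → ℝ) (hf : ConvexOn ℝ (Icc (0:ℝ) 1) f) (z t r u u' : ℝ)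
    (hz : z ∈ Icc (0:ℝ) 1) (ht : t ∈ Icc (0:ℝ) 1) (hzt : z ≠ t)
    (hmin : ∀ t ∈ Icc (0:ℝ) 1, f z ≤ f t)
    (hr0 : 0 < r) (hr1 : r < 1) (hu : f t ≤ u) (hu'0 : f z ≤ u')
    (hout : ∀ x ∈ Icc (0:ℝ) 1, r * |t - z| ≤ |x - z| → u' ≤ f x) :
    (∫ x in (0:ℝ)..1, pp f u' x) ≤ 4 * r ^ 3 * ∫ x in (0:ℝ)..1, pp f u x := by
  rcases lt_or_gt_of_ne hzt with h | h
  · exact core f hf z t r u u' hz ht h hmin hr0 hr1 hu hu'0 hout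
  · have refl : ∀ x ∈ Icc (0:ℝ) 1, 1 - x ∈ Icc (0:ℝ) 1 := fun x hx =>
      ⟨by linarith [hx.2], by linarith [hx.1]⟩
    have hg : ConvexOn ℝ (Icc (0:ℝ) 1) (fun x => f (1 - x)) := by
      refine ⟨convex_Icc 0 1, fun x hx y hy a b ha hb hab => ?_⟩
      have := hf.2 (refl x hx) (refl y hy) ha hb hab
      simp only [smul_eq_mul] at this ⊢
      rwa [show 1 - (a * x + b * y) = a * (1 - x) + b * (1 - y) by linear_combination - hab]
    have key := core (fun x => f (1 - x)) hg (1 - z) (1 - t) r u u' (refl z hz) (refl t ht)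
      (by linarith) (by intro x hx; simpa using hmin _ (refl x hx)) hr0 hr1 (by simpa using hu)
      (by simpa using hu'0) (by
        intro x hx hd
        apply hout _ (refl x hx)
        rw [show (1 - t - (1 - z)) = -(t - z) by ring, abs_neg] at hd
        rw [show 1 - x - z = -(x - (1 - z)) by ring, abs_neg]
        exact hd)
    have e : ∀ u, (∫ x in (0:ℝ)..1, pp (fun x => f (1 - x)) u x) = ∫ x in (0:ℝ)..1, pp f u x := by
      intro u
      have := intervalIntegral.integral_comp_sub_left (a := 0) (b := 1) (pp f u) 1
      simp only [sub_self, sub_zero] at this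
      exact this
    rwa [e, e] at key

/-- The set defining `rhoM`. -/
def AM (ε : ℝ) (f : ℝ → ℝ) (z : ℝ) : Set ℝ := {v | ∃ u, v = u - f z ∧ L2 f (trunc f u) ≤ ε}

lemma mem_AM (ε : ℝ) (f : ℝ → ℝ) (z v : ℝ) (hε : 0 < ε) :
    v ∈ AM ε f z ↔ (∫ t in (0:ℝ)..1, pp f (v + f z) t) ≤ ε ^ 2 := by
  constructor
  · rintro ⟨u, rfl, h⟩
    rw [L2_trunc, Real.sqrt_le_left hε.le] at h
    simpa using h
  · intro h
    refine ⟨v + f z, by ring, ?_⟩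
    rwa [L2_trunc, Real.sqrt_le_left hε.le]

lemma zero_mem_AM (ε : ℝ) (f : ℝ → ℝ) (z : ℝ) (hε : 0 < ε)
    (hmin : ∀ t ∈ Icc (0:ℝ) 1, f z ≤ f t) : (0:ℝ) ∈ AM ε f z := by
  rw [mem_AM _ _ _ _ hε]
  have : (∫ t in (0:ℝ)..1, pp f (0 + f z) t) = 0 := by
    refine (intervalIntegral.integral_congr (g := fun _ => (0:ℝ)) ?_).trans
      intervalIntegral.integral_zero
    intro x hx
    rw [uIcc_of_le zero_le_one] at hx
    have := hmin x hx
    simp only [pp]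
    rw [max_eq_right (by linarith)]; ring
  rw [this]; positivity

lemma bdd_AM (ε : ℝ) (f : ℝ → ℝ) (z : ℝ) (hε : 0 < ε) (hf : ConvexOn ℝ (Icc (0:ℝ) 1) f)
    (hmin : ∀ t ∈ Icc (0:ℝ) 1, f z ≤ f t) : BddAbove (AM ε f z) := by
  set B := max (f 0) (f 1) with hB
  have hfB : ∀ x ∈ Icc (0:ℝ) 1, f x ≤ B := by
    intro x hx
    have := comb f hf 0 x 1 (by simp) (by simp) hx.1 hx.2
    have h0 := mul_le_mul_of_nonneg_left (le_max_left (f 0) (f 1)) (sub_nonneg.2 hx.2)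
    have h1 := mul_le_mul_of_nonneg_left (le_max_right (f 0) (f 1)) hx.1
    rw [← hB] at h0 h1
    linarith
  refine ⟨B + ε - f z, fun v hv => ?_⟩
  rw [mem_AM _ _ _ _ hε] at hv
  by_contra hcon
  push Not at hcon
  have hl : (v + f z - B) ^ 2 ≤ ∫ t in (0:ℝ)..1, pp f (v + f z) t := by
    have e : (∫ t in (0:ℝ)..1, (v + f z - B) ^ 2) = (v + f z - B) ^ 2 := by simp
    rw [← e]
    apply intervalIntegral.integral_mono_on zero_le_one intervalIntegrable_const
      (pp_int01 f hf z _ hmin)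
    intro x hx
    unfold pp
    apply pow_le_pow_left₀ (by linarith)
    exact le_trans (by linarith [hfB x hx]) (le_max_left _ _)
  have : ε ^ 2 < (v + f z - B) ^ 2 := pow_lt_pow_left₀ (by linarith) hε.le (by norm_num)
  linarith

lemma rhoM_mem (ε : ℝ) (f : ℝ → ℝ) (z : ℝ) (hε : 0 < ε) (hf : ConvexOn ℝ (Icc (0:ℝ) 1) f)
    (hmin : ∀ t ∈ Icc (0:ℝ) 1, f z ≤ f t) :
    (∫ t in (0:ℝ)..1, pp f (rhoM ε f (f z) + f z) t) ≤ ε ^ 2 := by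
  rw [← mem_AM _ _ _ _ hε]
  refine IsClosed.csSup_mem ?_ ⟨0, zero_mem_AM ε f z hε hmin⟩ (bdd_AM ε f z hε hf hmin)
  have : AM ε f z = {v | (∫ t in (0:ℝ)..1, pp f (v + f z) t) ≤ ε ^ 2} := by
    ext v; exact mem_AM _ _ _ _ hε
  rw [this]
  exact isClosed_le ((h_cont f hf z hmin).comp (by fun_prop)) continuous_const

lemma rhoM_ge (ε : ℝ) (f : ℝ → ℝ) (z : ℝ) (hε : 0 < ε) (hf : ConvexOn ℝ (Icc (0:ℝ) 1) f)
    (hmin : ∀ t ∈ Icc (0:ℝ) 1, f z ≤ f t) :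
    ε ^ 2 ≤ (∫ t in (0:ℝ)..1, pp f (rhoM ε f (f z) + f z) t) := by
  by_contra hcon
  push Not at hcon
  have hc : Continuous (fun v => ∫ t in (0:ℝ)..1, pp f (v + f z) t) :=
    (h_cont f hf z hmin).comp (g := fun u => ∫ t in (0:ℝ)..1, pp f u t)
      (f := fun v => v + f z) (by fun_prop)
  have ev := hc.continuousAt.eventually (eventually_lt_nhds hcon)
  have ev2 : ∀ᶠ v in nhdsWithin (rhoM ε f (f z)) (Ioi (rhoM ε f (f z))),
    (∫ t in (0:ℝ)..1, pp f (v + f z) t) < ε ^ 2 := ev.filter_mono nhdsWithin_le_nhds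
  obtain ⟨v, h1, h2⟩ := (ev2.and self_mem_nhdsWithin).exists
  have := le_csSup (bdd_AM ε f z hε hf hmin) ((mem_AM ε f z v hε).2 h1.le)
  exact absurd (lt_of_lt_of_le h2 this) (lt_irrefl _)

/-- The set defining `rhoZ`. -/
def AZ (ε : ℝ) (f : ℝ → ℝ) (z : ℝ) : Set ℝ :=
  {v | ∃ t ∈ Icc (0:ℝ) 1, v = |t - z| ∧ f t ≤ rhoM ε f (f z) + f z}

lemma bdd_AZ (ε : ℝ) (f : ℝ → ℝ) (z : ℝ) (hz : z ∈ Icc (0:ℝ) 1) : BddAbove (AZ ε f z) := by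
  refine ⟨1, ?_⟩
  rintro v ⟨t, ht, rfl, -⟩
  rw [abs_le]
  constructor <;> linarith [ht.1, ht.2, hz.1, hz.2]

/-- Proposition 2.1, second part: max{(c/2)^(2/3), c} ≤ ρ_z(cε; f)/ρ_z(ε; f) ≤ 1. -/
theorem stmt3 (f : ℝ → ℝ) (z ε c : ℝ)
    (hf : ConvexOn ℝ (Icc (0:ℝ) 1) f) (hz : UniqueMinOn f z)
    (hε : 0 < ε) (hc0 : 0 < c) (hc1 : c < 1)
    (hpos : 0 < rhoZ ε f z (f z)) :
    max ((c/2) ^ ((2:ℝ)/3)) c ≤ rhoZ (c * ε) f z (f z) / rhoZ ε f z (f z) ∧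
      rhoZ (c * ε) f z (f z) / rhoZ ε f z (f z) ≤ 1 := by
  have hmin : ∀ t ∈ Icc (0:ℝ) 1, f z ≤ f t := by
    intro t ht
    by_cases h : t = z
    · rw [h]
    · exact (hz.2 t ht h).le
  have hcε : 0 < c * ε := mul_pos hc0 hε
  have hMpos : ∀ ε, 0 < ε → 0 ≤ rhoM ε f (f z) := fun ε hε =>
    le_csSup (bdd_AM ε f z hε hf hmin) (zero_mem_AM ε f z hε hmin)
  have hZne : ∀ ε, 0 < ε → (AZ ε f z).Nonempty := fun ε hε =>
    ⟨|z - z|, z, hz.1, rfl, by linarith [hMpos ε hε]⟩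
  have hle : c * ε ≤ ε := by nlinarith
  have hMmono : rhoM (c * ε) f (f z) ≤ rhoM ε f (f z) := by
    apply csSup_le_csSup (bdd_AM ε f z hε hf hmin) ⟨0, zero_mem_AM (c * ε) f z hcε hmin⟩
    rintro v ⟨u, rfl, h⟩
    exact ⟨u, rfl, h.trans hle⟩
  have hZmono : rhoZ (c * ε) f z (f z) ≤ rhoZ ε f z (f z) := by
    apply csSup_le_csSup (bdd_AZ ε f z hz.1) (hZne (c * ε) hcε)
    rintro v ⟨t, ht, rfl, h⟩
    exact ⟨t, ht, rfl, by linarith⟩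
  have hMc : c * rhoM ε f (f z) ≤ rhoM (c * ε) f (f z) := by
    apply le_csSup (bdd_AM (c * ε) f z hcε hf hmin)
    rw [mem_AM _ _ _ _ hcε]
    have h1 := rhoM_mem ε f z hε hf hmin
    have h2 : (∫ t in (0:ℝ)..1, pp f (c * rhoM ε f (f z) + f z) t) ≤
        ∫ t in (0:ℝ)..1, c ^ 2 * pp f (rhoM ε f (f z) + f z) t := by
      apply intervalIntegral.integral_mono_on zero_le_one (pp_int01 f hf z _ hmin)
        ((pp_int01 f hf z _ hmin).const_mul _)
      intro x hx
      unfold pp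
      rw [← mul_pow]
      have := hmin x hx
      apply pow_le_pow_left₀ (le_max_right _ _)
      apply max_le
      · refine le_trans ?_ (mul_le_mul_of_nonneg_left (le_max_left _ _) hc0.le)
        nlinarith
      · exact mul_nonneg hc0.le (le_max_right _ _)
    rw [intervalIntegral.integral_const_mul] at h2
    rw [mul_pow]
    exact h2.trans (mul_le_mul_of_nonneg_left h1 (sq_nonneg c))
  have hZc : rhoZ ε f z (f z) ≤ rhoZ (c * ε) f z (f z) / c := by
    apply csSup_le (hZne ε hε)
    rintro v ⟨t, ht, rfl, h⟩
    rw [le_div_iff₀ hc0]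
    apply le_csSup (bdd_AZ (c * ε) f z hz.1)
    have hconv := hf.2 hz.1 ht (by linarith : 0 ≤ 1 - c) hc0.le (by ring)
    have hmem := hf.1 hz.1 ht (by linarith : 0 ≤ 1 - c) hc0.le (by ring)
    simp only [smul_eq_mul] at hconv hmem
    refine ⟨_, hmem, ?_, ?_⟩
    · rw [show (1 - c) * z + c * t - z = c * (t - z) by ring, abs_mul, abs_of_pos hc0, mul_comm]
    · have := mul_le_mul_of_nonneg_left h hc0.le
      linarith
  have hκ0 : 0 < (c / 2) ^ ((2:ℝ) / 3) := Real.rpow_pos_of_pos (by linarith) _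
  have hκ1 : (c / 2) ^ ((2:ℝ) / 3) < 1 :=
    Real.rpow_lt_one (by linarith) (by linarith) (by norm_num)
  have hκ3 : ((c / 2) ^ ((2:ℝ) / 3)) ^ 3 = (c / 2) ^ 2 := by
    rw [← Real.rpow_natCast, ← Real.rpow_mul (by linarith), ← Real.rpow_natCast]
    norm_num
  have hZ0 : 0 ≤ rhoZ (c * ε) f z (f z) := by
    have := le_csSup (bdd_AZ (c * ε) f z hz.1)
      (⟨z, hz.1, rfl, by linarith [hMpos _ hcε]⟩ : |z - z| ∈ AZ (c * ε) f z)
    exact (abs_nonneg _).trans this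
  have hZk : rhoZ ε f z (f z) ≤ rhoZ (c * ε) f z (f z) / (c / 2) ^ ((2:ℝ) / 3) := by
    generalize (c / 2) ^ ((2:ℝ) / 3) = κ at *
    apply csSup_le (hZne ε hε)
    rintro v ⟨t, ht, rfl, h⟩
    rw [le_div_iff₀ hκ0]
    by_contra hcon
    push Not at hcon
    have hw : 0 < |t - z| := by
      by_contra hw
      have : |t - z| = 0 := le_antisymm (not_lt.1 hw) (abs_nonneg _)
      rw [this] at hcon
      linarith
    have hzt : z ≠ t := by
      rintro rfl; simp at hw
    obtain ⟨r, hr1, hr2⟩ := exists_between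
      ((div_lt_iff₀ hw).2 (by linarith) : rhoZ (c * ε) f z (f z) / |t - z| < κ)
    have hr0 : 0 < r := lt_of_le_of_lt (div_nonneg hZ0 hw.le) hr1
    rw [div_lt_iff₀ hw] at hr1
    have key := core2 f hf z t r _ (rhoM (c * ε) f (f z) + f z) hz.1 ht hzt hmin hr0
      (hr2.trans hκ1) h (by linarith [hMpos _ hcε]) (by
        intro x hx hd
        by_contra hlt
        push Not at hlt
        have := le_csSup (bdd_AZ (c * ε) f z hz.1)
          (⟨x, hx, rfl, hlt.le⟩ : |x - z| ∈ AZ (c * ε) f z)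
        exact absurd (lt_of_lt_of_le hr1 (hd.trans this)) (lt_irrefl _))
    have g1 := rhoM_ge (c * ε) f z hcε hf hmin
    have g2 := mul_le_mul_of_nonneg_left (rhoM_mem ε f z hε hf hmin)
      (by positivity : 0 ≤ 4 * r ^ 3)
    have g3 : r ^ 3 < κ ^ 3 := pow_lt_pow_left₀ hr2 hr0.le (by norm_num)
    rw [hκ3] at g3
    have g4 := mul_lt_mul_of_pos_right g3 (by positivity : 0 < ε ^ 2)
    have g5 : (c * ε) ^ 2 = 4 * ((c / 2) ^ 2 * ε ^ 2) := by ring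
    linarith
  refine ⟨max_le ?_ ?_, ?_⟩
  · rw [le_div_iff₀ hpos]
    rw [le_div_iff₀ hκ0] at hZk
    linarith
  · rw [le_div_iff₀ hpos]
    rw [le_div_iff₀ hc0] at hZc
    linarith
  · rw [div_le_one hpos]; exact hZmono
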